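/- (Key lemma for Feldman–Moore on quotients) Let F be a Borel enumerable equivalence relation on a quotient Borel space (X,E), i.e., F = ⋃_n ψ_n where each ψ_n is a Borel partial injection of (X,E) with graph contained in F. Then every Borel partial injection g₀ ∈ [[F]] is contained in the union g' ∪ g'' of two Borel automorphisms g', g'' of (X,E) whose graphs are contained in F. -/

import Mathlib

open MeasureTheory Set

/-- A subset of the quotient is Borel iff its preimage under the projection is Borel. -/
def QBorelSet {X : Type} [MeasurableSpace X] (E : Setoid X) (A : Set (Quotient E)) : Prop :=
  MeasurableSet (Quotient.mk E ⁻¹' A)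

/-- A relation between quotient Borel spaces is Borel iff its pullback to the
product of the standard Borel spaces is Borel. -/
def QBorelRel {X Y : Type} [MeasurableSpace X] [MeasurableSpace Y]
    (E : Setoid X) (F : Setoid Y) (R : Set (Quotient E × Quotient F)) : Prop :=
  MeasurableSet {p : X × Y | (Quotient.mk E p.1, Quotient.mk F p.2) ∈ R}

/-- A function between quotient Borel spaces is Borel iff its graph is a Borel relation. -/
def QBorelFun {X Y : Type} [MeasurableSpace X] [MeasurableSpace Y]
    (E : Setoid X) (F : Setoid Y) (f : Quotient E → Quotient F) : Prop :=
  MeasurableSet {p : X × Y | f (Quotient.mk E p.1) = Quotient.mk F p.2}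

/-- `E` is a countable Borel equivalence relation. -/
def CBER {X : Type} [MeasurableSpace X] (E : Setoid X) : Prop :=
  MeasurableSet {p : X × X | E.r p.1 p.2} ∧ ∀ x : X, {y | E.r x y}.Countable

/-- `E` is smooth: Borel reducible to equality on some standard Borel space. -/
def SmoothRel {X : Type} [MeasurableSpace X] (E : Setoid X) : Prop :=
  ∃ (Y : Type) (_ : MeasurableSpace Y) (_ : StandardBorelSpace Y) (f : X → Y),
    Measurable f ∧ ∀ x y : X, E.r x y ↔ f x = f y

/-- A set of pairs is a partial injection if it is the graph of an injective partial
function. -/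
def IsPartialInj {Q : Type} (G : Set (Q × Q)) : Prop :=
  (∀ x y y', (x, y) ∈ G → (x, y') ∈ G → y = y') ∧
  (∀ x x' y, (x, y) ∈ G → (x', y) ∈ G → x = x')

open Filter Topology Function

section CountableSections

variable {X Y Z : Type*}

/-- A set of pairs is a countable union of Borel graphs of partial functions. -/
def IsCountableUnionOfBorelGraphs [MeasurableSpace X] [MeasurableSpace Y]
    (B : Set (X × Y)) : Prop :=
  ∃ G : ℕ → Set (X × Y), (∀ n, MeasurableSet (G n)) ∧ (∀ n, InjOn Prod.fst (G n)) ∧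
    B = ⋃ n, G n

namespace IsCountableUnionOfBorelGraphs

variable [MeasurableSpace X] [MeasurableSpace Y] {B : Set (X × Y)}

theorem measurableSet (h : IsCountableUnionOfBorelGraphs B) : MeasurableSet B := by
  obtain ⟨G, hG, -, rfl⟩ := h
  exact MeasurableSet.iUnion hG

theorem of_injOn (hB : MeasurableSet B) (hinj : InjOn Prod.fst B) :
    IsCountableUnionOfBorelGraphs B :=
  ⟨fun _ => B, fun _ => hB, fun _ => hinj, (iUnion_const B).symm⟩

theorem empty : IsCountableUnionOfBorelGraphs (∅ : Set (X × Y)) :=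
  of_injOn MeasurableSet.empty (injOn_empty _)

theorem iUnion {ι : Type*} [Countable ι] {B : ι → Set (X × Y)}
    (h : ∀ i, IsCountableUnionOfBorelGraphs (B i)) :
    IsCountableUnionOfBorelGraphs (⋃ i, B i) := by
  cases isEmpty_or_nonempty ι
  · simpa using empty
  choose G hG hinj hB using h
  obtain ⟨e, he⟩ := exists_surjective_nat (ι × ℕ)
  refine ⟨fun n => G (e n).1 (e n).2, fun n => hG _ _, fun n => hinj _ _, ?_⟩
  rw [he.iUnion_comp (fun k : ι × ℕ => G k.1 k.2), iUnion_prod']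
  exact iUnion_congr hB

theorem union {C : Set (X × Y)} (hB : IsCountableUnionOfBorelGraphs B)
    (hC : IsCountableUnionOfBorelGraphs C) : IsCountableUnionOfBorelGraphs (B ∪ C) := by
  rw [union_eq_iUnion]
  exact iUnion fun b => by cases b <;> assumption

theorem measurableSet_image_fst [StandardBorelSpace X] [StandardBorelSpace Y]
    (h : IsCountableUnionOfBorelGraphs B) : MeasurableSet (Prod.fst '' B) := by
  obtain ⟨G, hG, hinj, rfl⟩ := h
  rw [image_iUnion]
  exact MeasurableSet.iUnion fun n => (hG n).image_of_measurable_injOn measurable_fst (hinj n)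

end IsCountableUnionOfBorelGraphs

/-- Finitely many analytic sets with empty intersection are contained in Borel sets with empty
intersection. -/
theorem exists_measurable_superset_of_iInter_eq_empty {ι : Type*} [Finite ι]
    [TopologicalSpace X] [PolishSpace X] [MeasurableSpace X] [BorelSpace X]
    {A : ι → Set X} (hA : ∀ i, AnalyticSet (A i)) (h : ⋂ i, A i = ∅) :
    ∃ D : ι → Set X, (∀ i, MeasurableSet (D i)) ∧ (∀ i, A i ⊆ D i) ∧ ⋂ i, D i = ∅ := by
  classical
  have := Fintype.ofFinite ι
  have inter : ∀ {C C' : Set X}, AnalyticSet C → AnalyticSet C' → AnalyticSet (C ∩ C') := by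
    intro C C' hC hC'
    rw [inter_eq_iInter]
    exact AnalyticSet.iInter fun b => by cases b <;> assumption
  have key : ∀ s : Finset ι, ∀ C : Set X, AnalyticSet C → C ∩ ⋂ i ∈ s, A i = ∅ →
      ∃ D : ι → Set X, (∀ i, MeasurableSet (D i)) ∧ (∀ i, A i ⊆ D i) ∧
        C ∩ ⋂ i ∈ s, D i = ∅ := by
    intro s
    induction s using Finset.induction_on with
    | empty =>
      intro C _ hC
      exact ⟨fun _ => univ, fun _ => MeasurableSet.univ, fun _ => subset_univ _,
        by simpa using hC⟩
    | insert a s ha ih =>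
      intro C hC h
      obtain ⟨D, hD, hAD, hCD⟩ := ih (C ∩ A a) (inter hC (hA a)) (by
        rw [← h, Finset.set_biInter_insert, inter_assoc])
      have hT : MeasurableSet (⋂ i ∈ s, D i) := s.measurableSet_biInter fun i _ => hD i
      obtain ⟨u, hu, hdisj, hum⟩ := (hA a).measurablySeparable (inter hC hT.analyticSet) (by
        rw [disjoint_iff_inter_eq_empty, ← hCD]
        ext; simp only [mem_inter_iff]; tauto)
      refine ⟨update D a u, fun i => ?_, fun i => ?_, ?_⟩
      · by_cases hi : i = a
        · subst hi; simpa using hum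
        · simpa [hi] using hD i
      · by_cases hi : i = a
        · subst hi; simpa using hu
        · simpa [hi] using hAD i
      · rw [Finset.set_biInter_insert, update_self]
        have : ⋂ i ∈ s, update D a u i = ⋂ i ∈ s, D i :=
          iInter₂_congr fun i hi => update_of_ne (ne_of_mem_of_not_mem hi ha) _ _
        rw [this, ← disjoint_iff_inter_eq_empty.1 hdisj]
        ext; simp only [mem_inter_iff]; tauto
  by_cases hι : Nonempty ι
  · obtain ⟨D, hD, hAD, hD0⟩ := key Finset.univ univ MeasurableSet.univ.analyticSet
      (by simpa using h)
    exact ⟨D, hD, hAD, by simpa using hD0⟩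
  · exact ⟨A, fun i => (hι ⟨i⟩).elim, fun i => subset_rfl, h⟩

variable [TopologicalSpace X] [PolishSpace X] [MeasurableSpace X] [BorelSpace X]
variable [TopologicalSpace Y] [PolishSpace Y] [MeasurableSpace Y] [BorelSpace Y]

/-- A Borel image which is the graph of a partial function is contained in the Borel graph of a
partial function. -/
theorem exists_borel_graph_superset [MeasurableSpace Z] [StandardBorelSpace Z]
    {f : Z → X × Y} (hf : Measurable f) {M : Set Z} (hM : MeasurableSet M)
    (hinj : InjOn Prod.fst (f '' M)) :
    ∃ G, MeasurableSet G ∧ InjOn Prod.fst G ∧ f '' M ⊆ G := by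
  obtain ⟨c, hc, hcinj⟩ :=
    MeasurableSpace.measurable_injection_nat_bool_of_countablySeparated Y
  have hS : ∀ n b, MeasurableSet {z | c (f z).2 n = b} := fun n b =>
    ((measurable_pi_apply n).comp (hc.comp hf.snd)) (measurableSet_singleton b)
  have hsep : ∀ n, MeasurablySeparable
      ((fun z => (f z).1) '' (M ∩ {z | c (f z).2 n = true}))
      ((fun z => (f z).1) '' (M ∩ {z | c (f z).2 n = false})) := by
    intro n
    refine AnalyticSet.measurablySeparable ((hM.inter (hS n _)).analyticSet_image hf.fst)
      ((hM.inter (hS n _)).analyticSet_image hf.fst) ?_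
    rw [Set.disjoint_left]
    rintro _ ⟨z, ⟨hz, hzn⟩, rfl⟩ ⟨w, ⟨hw, hwn⟩, hzw⟩
    have := hinj ⟨w, hw, rfl⟩ ⟨z, hz, rfl⟩ hzw
    simp only [mem_ofPred_eq, this] at hzn hwn
    simp [hzn] at hwn
  choose D hD hDdisj hDm using hsep
  refine ⟨{p | ∀ n, c p.2 n = true ↔ p.1 ∈ D n}, ?_, ?_, ?_⟩
  · rw [ofPred_forall]
    refine MeasurableSet.iInter fun n => MeasurableSet.iff ?_ (measurable_fst (hDm n))
    exact ((measurable_pi_apply n).comp (hc.comp measurable_snd)) (measurableSet_singleton true)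
  · rintro ⟨x, y⟩ h ⟨x', y'⟩ h' (rfl : x = x')
    congr 1
    refine hcinj (funext fun n => ?_)
    rw [Bool.eq_iff_iff]
    exact (h n).trans (h' n).symm
  · rintro _ ⟨z, hz, rfl⟩ n
    refine ⟨fun h => hD n ⟨z, ⟨hz, h⟩, rfl⟩, fun h => ?_⟩
    by_contra hn
    exact Set.disjoint_left.1 (hDdisj n) ⟨z, ⟨hz, by simpa using hn⟩, rfl⟩ h

/-- If no point has at least two elements in its section of each of finitely many Borel images,
then the fibre product of these images has a coordinate in some countable union of Borel graphs. -/
theorem exists_countableUnion_of_forall_section_subsingleton {ι : Type*} [Finite ι]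
    [MeasurableSpace Z] [StandardBorelSpace Z] {f : Z → X × Y} (hf : Measurable f)
    {M : ι → Set Z} (hM : ∀ i, MeasurableSet (M i))
    (h : ¬ ∃ x, ∀ i, ∃ z ∈ M i, ∃ w ∈ M i, (f z).1 = x ∧ (f w).1 = x ∧ (f z).2 ≠ (f w).2) :
    ∃ B, IsCountableUnionOfBorelGraphs B ∧
      ∀ x, ∀ a : ι → Z, (∀ i, a i ∈ M i) → (∀ i, (f (a i)).1 = x) → ∃ i, f (a i) ∈ B := by
  let A : ι → Set X := fun i => (fun p : Z × Z => (f p.1).1) ''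
    {p | p.1 ∈ M i ∧ p.2 ∈ M i ∧ (f p.1).1 = (f p.2).1 ∧ (f p.1).2 ≠ (f p.2).2}
  have hA : ∀ i, AnalyticSet (A i) := by
    intro i
    refine MeasurableSet.analyticSet_image ?_ (hf.comp measurable_fst).fst
    refine (measurable_fst (hM i)).inter ((measurable_snd (hM i)).inter
      (MeasurableSet.inter ?_ (MeasurableSet.compl ?_)))
    · exact measurableSet_eq_fun (hf.comp measurable_fst).fst (hf.comp measurable_snd).fst
    · exact measurableSet_eq_fun (hf.comp measurable_fst).snd (hf.comp measurable_snd).snd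
  obtain ⟨D, hD, hAD, hD0⟩ := exists_measurable_superset_of_iInter_eq_empty hA (by
    rw [eq_empty_iff_forall_notMem]
    intro x hx
    refine h ⟨x, fun i => ?_⟩
    obtain ⟨⟨z, w⟩, ⟨hz, hw, h1, h2⟩, rfl⟩ := mem_iInter.1 hx i
    exact ⟨z, hz, w, hw, rfl, h1.symm, h2⟩)
  have hG : ∀ i, ∃ G, MeasurableSet G ∧ InjOn Prod.fst G ∧
      f '' (M i ∩ {z | (f z).1 ∉ D i}) ⊆ G := by
    intro i
    refine exists_borel_graph_superset hf ((hM i).inter (hf.fst (hD i).compl)) ?_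
    rintro _ ⟨z, ⟨hz, hzD⟩, rfl⟩ _ ⟨w, ⟨hw, -⟩, rfl⟩ hzw
    by_contra hne
    exact hzD (hAD i ⟨(z, w), ⟨hz, hw, hzw, fun h2 => hne (Prod.ext hzw h2)⟩, rfl⟩)
  choose G hGm hGinj hG using hG
  refine ⟨⋃ i, G i, .iUnion fun i => .of_injOn (hGm i) (hGinj i), fun x a ha hx => ?_⟩
  have : x ∉ ⋂ i, D i := by simp [hD0]
  obtain ⟨i, hi⟩ := by simpa using this
  exact ⟨i, mem_iUnion.2 ⟨i, hG i ⟨a i, ⟨ha i, by simpa [hx i] using hi⟩, rfl⟩⟩⟩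

/-- For every countable union `B` of Borel graphs, the fibre product over `X` of the images of the
sets `s i` has an element none of whose coordinates lies in `B`. -/
def LargeFamily {ι : Type*} (f : Z → X × Y) (s : ι → Set Z) : Prop :=
  ∀ B, IsCountableUnionOfBorelGraphs B →
    ∃ a : ι → Z, (∀ i, a i ∈ s i) ∧ (∀ i j, (f (a i)).1 = (f (a j)).1) ∧ ∀ i, f (a i) ∉ B

theorem LargeFamily.exists_split {ι : Type*} [Finite ι] [Nonempty ι] [MetricSpace Z]
    [CompleteSpace Z] [SecondCountableTopology Z] {f : Z → X × Y} (hf : Continuous f) {s : ι → Set Z}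
    (hs : ∀ i, IsOpen (s i)) (h : LargeFamily f s) {ε : ℝ} (hε : 0 < ε) :
    ∃ t : ι × Bool → Set Z, (∀ k, IsOpen (t k)) ∧ LargeFamily f t ∧
      (∀ k, closure (t k) ⊆ s k.1) ∧ (∀ k, ∀ u ∈ t k, ∀ v ∈ t k, dist u v ≤ ε) ∧
      ∀ i, ∀ u ∈ closure (t (i, true)), ∀ v ∈ closure (t (i, false)), (f u).2 ≠ (f v).2 := by
  classical
  by_contra hcon
  have : PolishSpace Z := inferInstance
  borelize Z
  let b := TopologicalSpace.countableBasis Z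
  have hb := TopologicalSpace.isBasis_countableBasis Z
  have : Countable b := (TopologicalSpace.countable_countableBasis Z).to_subtype
  let T := {t : ι × Bool → b | (∀ k, closure (t k : Set Z) ⊆ s k.1) ∧
    (∀ k, ∀ u ∈ (t k : Set Z), ∀ v ∈ (t k : Set Z), dist u v ≤ ε) ∧
      ∀ i, ∀ u ∈ closure (t (i, true) : Set Z), ∀ v ∈ closure (t (i, false) : Set Z),
        (f u).2 ≠ (f v).2}
  have hT : ∀ t : T, ∃ B, IsCountableUnionOfBorelGraphs B ∧
      ∀ a : ι × Bool → Z, (∀ k, a k ∈ (t.1 k : Set Z)) →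
        (∀ k l, (f (a k)).1 = (f (a l)).1) → ∃ k, f (a k) ∈ B := by
    rintro ⟨t, ht1, ht2, ht3⟩
    by_contra hlarge
    refine hcon ⟨fun k => t k, fun k => hb.isOpen (t k).2, fun B hB => ?_, ht1, ht2, ht3⟩
    by_contra hB'
    refine hlarge ⟨B, hB, fun a ha hfib => ?_⟩
    by_contra hBa
    exact hB' ⟨a, ha, hfib, fun k hk => hBa ⟨k, hk⟩⟩
  choose B hB hBT using hT
  have hBU := IsCountableUnionOfBorelGraphs.iUnion hB
  have hx : ∃ x, ∀ i, ∃ z ∈ s i \ f ⁻¹' ⋃ t, B t, ∃ w ∈ s i \ f ⁻¹' ⋃ t, B t,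
      (f z).1 = x ∧ (f w).1 = x ∧ (f z).2 ≠ (f w).2 := by
    by_contra hx
    obtain ⟨B', hB', hB'a⟩ := exists_countableUnion_of_forall_section_subsingleton hf.measurable
      (fun i => (hs i).measurableSet.diff (hf.measurable hBU.measurableSet)) hx
    obtain ⟨a, ha, hfib, hau⟩ := h _ (hBU.union hB')
    have hau' : ∀ i, f (a i) ∉ ⋃ t, B t := fun i hi => hau i (Or.inl hi)
    let i₀ := Classical.arbitrary ι
    obtain ⟨i, hi⟩ := hB'a (f (a i₀)).1 a (fun i => ⟨ha i, hau' i⟩) fun i => hfib i i₀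
    exact hau i (Or.inr hi)
  obtain ⟨x, hx⟩ := hx
  have hV : ∀ i, ∃ c : Bool → Z, ∃ V : Bool → b, (∀ j, c j ∈ (V j : Set Z)) ∧
      (∀ j, (f (c j)).1 = x) ∧ (∀ j, f (c j) ∉ ⋃ t, B t) ∧
      (∀ j, closure (V j : Set Z) ⊆ s i) ∧
      (∀ j, ∀ u ∈ (V j : Set Z), ∀ v ∈ (V j : Set Z), dist u v ≤ ε) ∧
      ∀ u ∈ closure (V true : Set Z), ∀ v ∈ closure (V false : Set Z), (f u).2 ≠ (f v).2 := by
    intro i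
    obtain ⟨z, ⟨hz, hzB⟩, w, ⟨hw, hwB⟩, hzx, hwx, hne⟩ := hx i
    obtain ⟨O, O', hO, hO', hzO, hwO', hOO'⟩ := t2_separation hne
    have nhd : ∀ z ∈ s i, ∀ O : Set Y, IsOpen O → (f z).2 ∈ O →
        ∃ V ∈ b, z ∈ V ∧ closure V ⊆ s i ∩ ((fun z => (f z).2) ⁻¹' O ∩ Metric.ball z (ε / 2)) := by
      intro z hz O hO hzO
      refine hb.exists_closure_subset (IsOpen.mem_nhds ?_
        ⟨hz, hzO, Metric.mem_ball_self (half_pos hε)⟩)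
      exact (hs i).inter ((hO.preimage hf.snd).inter Metric.isOpen_ball)
    obtain ⟨V, hVb, hzV, hV⟩ := nhd z hz O hO hzO
    obtain ⟨W, hWb, hwW, hW⟩ := nhd w hw O' hO' hwO'
    have hdist : ∀ {z : Z} {V : Set Z}, V ⊆ Metric.ball z (ε / 2) →
        ∀ u ∈ V, ∀ v ∈ V, dist u v ≤ ε := by
      intro z V hV u hu v hv
      have h1 := Metric.mem_ball.1 (hV hu)
      have h2 := Metric.mem_ball.1 (hV hv)
      linarith [dist_triangle_right u v z]
    refine ⟨fun j => cond j z w, fun j => cond j ⟨V, hVb⟩ ⟨W, hWb⟩, ?_, ?_, ?_, ?_, ?_, ?_⟩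
    · rintro (_ | _) <;> assumption
    · rintro (_ | _) <;> assumption
    · rintro (_ | _) <;> assumption
    · rintro (_ | _)
      · exact fun u hu => (hW hu).1
      · exact fun u hu => (hV hu).1
    · rintro (_ | _)
      · exact hdist fun u hu => (hW (subset_closure hu)).2.2
      · exact hdist fun u hu => (hV (subset_closure hu)).2.2
    · exact fun u hu v hv => hOO'.ne_of_mem (hV hu).2.1 (hW hv).2.1
  choose c V hcV hcx hcB hVs hVε hVne using hV
  obtain ⟨k, hk⟩ := hBT ⟨fun k => V k.1 k.2, fun k => hVs _ _, fun k => hVε _ _, hVne⟩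
    (fun k => c k.1 k.2) (fun k => hcV _ _) fun k l => (hcx _ _).trans (hcx _ _).symm
  exact hcB k.1 k.2 (mem_iUnion.2 ⟨_, hk⟩)

/-- The index type of the `n`-th level of the binary tree. -/
def BinaryLevel : ℕ → Type
  | 0 => Unit
  | n + 1 => BinaryLevel n × Bool

theorem finite_binaryLevel : ∀ n, Finite (BinaryLevel n)
  | 0 => inferInstanceAs (Finite Unit)
  | n + 1 => by
    have := finite_binaryLevel n
    exact inferInstanceAs (Finite (BinaryLevel n × Bool))

/-- The vertex of a branch at level `n`. -/
def branchVertex (σ : ℕ → Bool) : (n : ℕ) → BinaryLevel n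
  | 0 => ()
  | n + 1 => (branchVertex σ n, σ n)

theorem branchVertex_congr {σ τ : ℕ → Bool} :
    ∀ {n : ℕ}, (∀ m < n, σ m = τ m) → branchVertex σ n = branchVertex τ n
  | 0, _ => rfl
  | n + 1, h => by
    have h' := branchVertex_congr fun m hm => h m (Nat.lt_succ_of_lt hm)
    exact Prod.ext h' (h n n.lt_succ_self)

theorem LargeFamily.exists_not_countable_section [MetricSpace Z] [CompleteSpace Z]
    [SecondCountableTopology Z] {f : Z → X × Y} (hf : Continuous f)
    (h : LargeFamily f fun _ : BinaryLevel 0 => univ) :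
    ∃ x, ¬ {y | (x, y) ∈ range f}.Countable := by
  let State : ℕ → Type _ := fun n =>
    {s : BinaryLevel n → Set Z // (∀ i, IsOpen (s i)) ∧ LargeFamily f s}
  have step : ∀ n, ∀ s : State n, ∃ t : State (n + 1),
      (∀ i b, closure (t.1 (i, b)) ⊆ s.1 i) ∧
      (∀ k, ∀ u ∈ t.1 k, ∀ v ∈ t.1 k, dist u v ≤ 1 * (1 / 2 : ℝ) ^ n) ∧
      ∀ i, ∀ u ∈ closure (t.1 (i, true)), ∀ v ∈ closure (t.1 (i, false)), (f u).2 ≠ (f v).2 := by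
    rintro n ⟨s, hs, hl⟩
    have := finite_binaryLevel n
    have : Nonempty (BinaryLevel n) := ⟨branchVertex (fun _ => true) n⟩
    obtain ⟨t, ht, htl, h1, h2, h3⟩ :=
      hl.exists_split hf hs (ε := 1 * (1 / 2 : ℝ) ^ n) (by positivity)
    exact ⟨⟨t, ht, htl⟩, fun i b => h1 (i, b), h2, h3⟩
  choose next hclos hdist hne using step
  let S : ∀ n, State n := fun n =>
    Nat.rec (motive := State) ⟨fun _ => univ, fun _ => isOpen_univ, h⟩ next n
  choose a ha hfib _ using fun n => (S n).2.2 ∅ .empty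
  let u : (ℕ → Bool) → ℕ → Z := fun σ n => a n (branchVertex σ n)
  have hsub : ∀ σ n, closure ((S (n + 1)).1 (branchVertex σ (n + 1))) ⊆
      (S n).1 (branchVertex σ n) := fun σ n => hclos n (S n) _ _
  have hanti : ∀ σ, Antitone fun n => (S n).1 (branchVertex σ n) := fun σ =>
    antitone_nat_of_succ_le fun n => subset_closure.trans (hsub σ n)
  have hmem : ∀ σ {n m}, n ≤ m → u σ m ∈ (S n).1 (branchVertex σ n) := fun σ n m hnm =>
    hanti σ hnm (ha m _)
  have hlim : ∀ σ, ∃ z, Tendsto (u σ) atTop (𝓝 z) := by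
    intro σ
    have hc : CauchySeq fun n => u σ (n + 1) :=
      cauchySeq_of_le_geometric (1 / 2) 1 (by norm_num) fun n =>
        hdist n (S n) (branchVertex σ (n + 1)) _
          (hmem σ (n := n + 1) le_rfl) _
          (hmem σ (n + 1).le_succ)
    obtain ⟨z, hz⟩ := cauchySeq_tendsto_of_complete hc
    exact ⟨z, (tendsto_add_atTop_iff_nat 1).1 hz⟩
  choose z hz using hlim
  have hzmem : ∀ σ n, z σ ∈ closure ((S n).1 (branchVertex σ n)) := fun σ n =>
    mem_closure_of_tendsto (hz σ) (eventually_atTop.2 ⟨n, fun m hm => hmem σ hm⟩)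
  have hfst : ∀ σ τ, (f (z σ)).1 = (f (z τ)).1 := by
    intro σ τ
    have h1 := (hf.fst.tendsto (z σ)).comp (hz σ)
    have h2 := (hf.fst.tendsto (z τ)).comp (hz τ)
    refine tendsto_nhds_unique h1 (h2.congr fun n => hfib n _ _)
  have hsnd : Injective fun σ => (f (z σ)).2 := by
    intro σ τ hστ
    by_contra hcon
    have hex : ∃ n, σ n ≠ τ n := by
      by_contra! hall
      exact hcon (funext hall)
    classical
    have hbr : branchVertex σ (Nat.find hex) = branchVertex τ (Nat.find hex) :=
      branchVertex_congr fun m hm => by simpa using Nat.find_min hex hm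
    have hn := Nat.find_spec hex
    have h1 := hzmem σ (Nat.find hex + 1)
    have h2 := hzmem τ (Nat.find hex + 1)
    simp only [branchVertex, ← hbr] at h1 h2
    generalize Nat.find hex = n at *
    cases hσ : σ n <;> cases hτ : τ n <;> simp only [hσ, hτ, ne_eq, not_true_eq_false] at hn h1 h2
    · exact hne n (S n) _ _ h2 _ h1 hστ.symm
    · exact hne n (S n) _ _ h1 _ h2 hστ
  refine ⟨(f (z fun _ => true)).1, fun hcount => ?_⟩
  have hpre := hcount.preimage hsnd
  have huniv : (fun σ => (f (z σ)).2) ⁻¹' {y | ((f (z fun _ => true)).1, y) ∈ range f} = univ :=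
    eq_univ_of_forall fun σ => ⟨z σ, Prod.ext (hfst _ _) rfl⟩
  rw [huniv, countable_univ_iff] at hpre
  obtain ⟨e, he⟩ := exists_surjective_nat (ℕ → Bool)
  obtain ⟨n, hn⟩ := he fun n => !(e n n)
  simpa using congrFun hn n

end CountableSections

/-- A Borel set with countable sections is a countable union of Borel graphs of partial
functions. -/
theorem MeasurableSet.isCountableUnionOfBorelGraphs {X Y : Type*} [MeasurableSpace X]
    [StandardBorelSpace X] [MeasurableSpace Y] [StandardBorelSpace Y] {P : Set (X × Y)}
    (hP : MeasurableSet P) (hcount : ∀ x, {y | (x, y) ∈ P}.Countable) :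
    IsCountableUnionOfBorelGraphs P := by
  let := upgradeStandardBorel X
  let := upgradeStandardBorel Y
  obtain ⟨Z, _, _, f, hf, rfl⟩ := analyticSet_iff_exists_polishSpace_range.1 hP.analyticSet
  let := TopologicalSpace.upgradeIsCompletelyMetrizable Z
  by_contra hcon
  have hl : LargeFamily f fun _ : BinaryLevel 0 => univ := by
    intro B hB
    by_contra hBa
    refine hcon ?_
    obtain ⟨G, hG, hinj, rfl⟩ := hB
    refine ⟨fun n => G n ∩ range f, fun n => (hG n).inter hP,
      fun n => (hinj n).mono inter_subset_left, ?_⟩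
    rw [← iUnion_inter, eq_comm, inter_eq_right]
    rintro _ ⟨z, rfl⟩
    by_contra hz
    exact hBa ⟨fun _ => z, fun _ => mem_univ _, fun _ _ => rfl, fun _ => hz⟩
  obtain ⟨x, hx⟩ := hl.exists_not_countable_section hf
  exact hx (hcount x)

/-- The projection of a Borel set with countable sections is Borel. -/
theorem MeasurableSet.image_fst_of_countable_sections {X Y : Type*} [MeasurableSpace X]
    [StandardBorelSpace X] [MeasurableSpace Y] [StandardBorelSpace Y] {P : Set (X × Y)}
    (hP : MeasurableSet P) (hcount : ∀ x, {y | (x, y) ∈ P}.Countable) :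
    MeasurableSet (Prod.fst '' P) :=
  (hP.isCountableUnionOfBorelGraphs hcount).measurableSet_image_fst

theorem IsPartialInj.swap {Q : Type} {g : Set (Q × Q)} (hg : IsPartialInj g) :
    IsPartialInj (Prod.swap ⁻¹' g) :=
  ⟨fun x y y' h h' => hg.2 y y' x h h', fun x x' y h h' => hg.1 y x x' h h'⟩

theorem IsPartialInj.mono {Q : Type} {g h : Set (Q × Q)} (hg : IsPartialInj g) (hhg : h ⊆ g) :
    IsPartialInj h :=
  ⟨fun x y y' hy hy' => hg.1 x y y' (hhg hy) (hhg hy'),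
    fun x x' y hx hx' => hg.2 x x' y (hhg hx) (hhg hx')⟩

/-- The points reached from `dom g \ rng g` by applying the partial function `g` exactly `n`
times. -/
def initialOrbit {Q : Type} (g : Set (Q × Q)) : ℕ → Set Q
  | 0 => {x | (∃ y, (x, y) ∈ g) ∧ ¬ ∃ w, (w, x) ∈ g}
  | n + 1 => {y | ∃ x, (x, y) ∈ g ∧ x ∈ initialOrbit g n}

section InitialOrbit

variable {Q : Type} {g : Set (Q × Q)}

theorem notMem_initialOrbit_zero {x y : Q} (h : (x, y) ∈ g) : y ∉ initialOrbit g 0 :=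
  fun hy => hy.2 ⟨x, h⟩

theorem mem_initialOrbit_succ_iff (hg : IsPartialInj g) {x y : Q} (h : (x, y) ∈ g) {n : ℕ} :
    y ∈ initialOrbit g (n + 1) ↔ x ∈ initialOrbit g n :=
  ⟨fun ⟨x', h', hx'⟩ => hg.2 x' x y h' h ▸ hx', fun hx => ⟨x, h, hx⟩⟩

theorem eq_of_mem_initialOrbit (hg : IsPartialInj g) :
    ∀ {n m : ℕ} {x : Q}, x ∈ initialOrbit g n → x ∈ initialOrbit g m → n = m
  | 0, 0, _, _, _ => rfl
  | 0, _ + 1, _, h, ⟨_, hw, _⟩ => (notMem_initialOrbit_zero hw h).elim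
  | _ + 1, 0, _, ⟨_, hw, _⟩, h => (notMem_initialOrbit_zero hw h).elim
  | _ + 1, _ + 1, _, ⟨_, hw, hwn⟩, h =>
    congrArg (· + 1) (eq_of_mem_initialOrbit hg hwn ((mem_initialOrbit_succ_iff hg hw).1 h))

theorem exists_notMem_range_of_mem_initialOrbit {F : Q → Q → Prop} (hF : Equivalence F)
    (hgF : ∀ p ∈ g, F p.1 p.2) :
    ∀ {n : ℕ} {x : Q}, x ∈ initialOrbit g n → ∃ z, F z x ∧ ¬ ∃ w, (w, z) ∈ g
  | 0, x, h => ⟨x, hF.refl x, h.2⟩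
  | _ + 1, _, ⟨_, hw, hwn⟩ =>
    let ⟨z, hz, hzg⟩ := exists_notMem_range_of_mem_initialOrbit hF hgF hwn
    ⟨z, hF.trans hz (hgF _ hw), hzg⟩

end InitialOrbit

section QuotientBorel

variable {X : Type} [MeasurableSpace X] {E : Setoid X}

theorem QBorelRel.swap {R : Set (Quotient E × Quotient E)} (hR : QBorelRel E E R) :
    QBorelRel E E (Prod.swap ⁻¹' R) :=
  measurable_swap hR

theorem QBorelRel.union {R S : Set (Quotient E × Quotient E)} (hR : QBorelRel E E R)
    (hS : QBorelRel E E S) : QBorelRel E E (R ∪ S) :=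
  MeasurableSet.union hR hS

theorem QBorelRel.inter {R S : Set (Quotient E × Quotient E)} (hR : QBorelRel E E R)
    (hS : QBorelRel E E S) : QBorelRel E E (R ∩ S) :=
  MeasurableSet.inter hR hS

theorem QBorelSet.compl {A : Set (Quotient E)} (hA : QBorelSet E A) : QBorelSet E Aᶜ :=
  MeasurableSet.compl hA

theorem QBorelSet.inter {A B : Set (Quotient E)} (hA : QBorelSet E A) (hB : QBorelSet E B) :
    QBorelSet E (A ∩ B) :=
  MeasurableSet.inter hA hB

theorem QBorelSet.iUnion {ι : Sort*} [Countable ι] {A : ι → Set (Quotient E)}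
    (hA : ∀ i, QBorelSet E (A i)) : QBorelSet E (⋃ i, A i) := by
  rw [QBorelSet, preimage_iUnion]
  exact MeasurableSet.iUnion hA

theorem QBorelRel.iUnion {ι : Sort*} [Countable ι] {R : ι → Set (Quotient E × Quotient E)}
    (hR : ∀ i, QBorelRel E E (R i)) : QBorelRel E E (⋃ i, R i) := by
  have : {p : X × X | (Quotient.mk E p.1, Quotient.mk E p.2) ∈ ⋃ i, R i} =
      ⋃ i, {p : X × X | (Quotient.mk E p.1, Quotient.mk E p.2) ∈ R i} := by
    ext; simp
  rw [QBorelRel, this]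
  exact MeasurableSet.iUnion hR

theorem QBorelSet.preimage_fst {A : Set (Quotient E)} (hA : QBorelSet E A) :
    QBorelRel E E (Prod.fst ⁻¹' A) :=
  measurable_fst hA

theorem QBorelSet.preimage_snd {A : Set (Quotient E)} (hA : QBorelSet E A) :
    QBorelRel E E (Prod.snd ⁻¹' A) :=
  measurable_snd hA

theorem CBER.qBorelRel_diagonal (hE : CBER E) : QBorelRel E E {p | p.1 = p.2} := by
  have : {p : X × X | (Quotient.mk E p.1, Quotient.mk E p.2) ∈
      {p : Quotient E × Quotient E | p.1 = p.2}} = {p : X × X | E.r p.1 p.2} := by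
    ext p; exact Quotient.eq
  rw [QBorelRel, this]
  exact hE.1

theorem QBorelRel.domain [StandardBorelSpace X] (hE : CBER E)
    {R : Set (Quotient E × Quotient E)} (hR : QBorelRel E E R)
    (hfun : ∀ x y y', (x, y) ∈ R → (x, y') ∈ R → y = y') :
    QBorelSet E {x | ∃ y, (x, y) ∈ R} := by
  have himage : Quotient.mk E ⁻¹' {x | ∃ y, (x, y) ∈ R} =
      Prod.fst '' {p : X × X | (Quotient.mk E p.1, Quotient.mk E p.2) ∈ R} := by
    ext x
    constructor
    · rintro ⟨⟨y⟩, hy⟩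
      exact ⟨(x, y), hy, rfl⟩
    · rintro ⟨⟨x, y⟩, hy, rfl⟩
      exact ⟨_, hy⟩
  rw [QBorelSet, himage]
  refine MeasurableSet.image_fst_of_countable_sections hR fun x => ?_
  rcases eq_empty_or_nonempty
    {y | (x, y) ∈ {p : X × X | (Quotient.mk E p.1, Quotient.mk E p.2) ∈ R}} with h | ⟨y₀, hy₀⟩
  · rw [h]; exact countable_empty
  · exact (hE.2 y₀).mono fun y hy => Quotient.exact (hfun _ _ _ hy₀ hy)

theorem QBorelRel.range [StandardBorelSpace X] (hE : CBER E)
    {R : Set (Quotient E × Quotient E)} (hR : QBorelRel E E R)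
    (hinj : ∀ x x' y, (x, y) ∈ R → (x', y) ∈ R → x = x') :
    QBorelSet E {y | ∃ x, (x, y) ∈ R} :=
  hR.swap.domain hE fun y x x' => hinj x x' y

theorem QBorelRel.initialOrbit [StandardBorelSpace X] (hE : CBER E)
    {g : Set (Quotient E × Quotient E)} (hg : QBorelRel E E g) (hinj : IsPartialInj g) :
    ∀ n, QBorelSet E (initialOrbit g n)
  | 0 => (hg.domain hE hinj.1).inter (hg.range hE hinj.2).compl
  | n + 1 => (hg.inter (hg.initialOrbit hE hinj n).preimage_fst).range hE
      (hinj.mono inter_subset_left).2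

/-- A Borel partial injection whose domain and range are both `C`, together with a Borel partial
injection whose domain and range are disjoint from each other and from `C`, extends to a Borel
automorphism. -/
theorem exists_borel_automorphism_extending [StandardBorelSpace X] (hE : CBER E)
    {F : Quotient E → Quotient E → Prop} (hF : Equivalence F)
    {k h : Set (Quotient E × Quotient E)} {C : Set (Quotient E)}
    (hkB : QBorelRel E E k) (hhB : QBorelRel E E h) (hC : QBorelSet E C)
    (hk : IsPartialInj k) (hh : IsPartialInj h)
    (hkF : ∀ p ∈ k, F p.1 p.2) (hhF : ∀ p ∈ h, F p.1 p.2)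
    (hkdom : ∀ x, x ∈ C ↔ ∃ y, (x, y) ∈ k) (hkrng : ∀ y, y ∈ C ↔ ∃ x, (x, y) ∈ k)
    (hhC : ∀ x y, (x, y) ∈ h → x ∉ C ∧ y ∉ C)
    (hhh : ∀ x y z, (x, y) ∈ h → (y, z) ∉ h) :
    ∃ f : Quotient E → Quotient E, Bijective f ∧ QBorelFun E E f ∧ (∀ x, F x (f x)) ∧
      ∀ p ∈ k ∪ h, f p.1 = p.2 := by
  let D : Set (Quotient E) := {x | ∃ y, (x, y) ∈ h}
  let R : Set (Quotient E) := {y | ∃ x, (x, y) ∈ h}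
  let G : Set (Quotient E × Quotient E) :=
    (k ∪ h) ∪ (Prod.swap ⁻¹' h ∪ ({p | p.1 = p.2} ∩ Prod.fst ⁻¹' (Cᶜ ∩ (Dᶜ ∩ Rᶜ))))
  have hGB : QBorelRel E E G :=
    (hkB.union hhB).union (hhB.swap.union (hE.qBorelRel_diagonal.inter
      (hC.compl.inter ((hhB.domain hE hh.1).compl.inter
        (hhB.range hE hh.2).compl)).preimage_fst))
  have hG : ∀ x y, (x, y) ∈ G ↔ (x, y) ∈ k ∨ (x, y) ∈ h ∨ (y, x) ∈ h ∨
      (x = y ∧ x ∉ C ∧ (¬ ∃ z, (x, z) ∈ h) ∧ ¬ ∃ z, (z, x) ∈ h) := by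
    intro x y
    simp only [G, D, R, mem_union, mem_inter_iff, mem_preimage, mem_compl_iff, mem_ofPred_eq,
      Prod.swap_prod_mk, or_assoc]
  have htotal : ∀ x, ∃ y, (x, y) ∈ G := by
    intro x
    simp only [hG]
    grind
  have hsurj : ∀ y, ∃ x, (x, y) ∈ G := by
    intro y
    simp only [hG]
    grind
  have hfun : ∀ x y y', (x, y) ∈ G → (x, y') ∈ G → y = y' := by
    intro x y y'
    simp only [hG]
    have := hk.1 x y y'
    have := hh.1 x y y'
    have := hh.2 y y' x
    grind
  have hinj : ∀ x x' y, (x, y) ∈ G → (x', y) ∈ G → x = x' := by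
    intro x x' y
    simp only [hG]
    have := hk.2 x x' y
    have := hh.2 x x' y
    have := hh.1 y x x'
    grind
  choose f hf using htotal
  have hfG : ∀ x y, f x = y ↔ (x, y) ∈ G := fun x y =>
    ⟨fun h => h ▸ hf x, fun h => hfun x _ _ (hf x) h⟩
  refine ⟨f, ⟨fun x x' h => hinj x x' (f x) (hf x) (h ▸ hf x'), fun y => ?_⟩, ?_, fun x => ?_, ?_⟩
  · obtain ⟨x, hx⟩ := hsurj y
    exact ⟨x, (hfG x y).2 hx⟩
  · simp only [QBorelFun, hfG]
    exact hGB
  · rcases (hG _ _).1 (hf x) with h' | h' | h' | h'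
    · exact hkF _ h'
    · exact hhF _ h'
    · exact hF.symm (hhF _ h')
    · exact h'.1 ▸ hF.refl x
  · rintro ⟨x, y⟩ hp
    exact (hfG x y).2 (Or.inl hp)

/-- If `F` is enumerated by Borel partial injections, every Borel partial injection contained in
`F` extends to one which is maximal in `F`. -/
theorem exists_maximal_borel_partialInj [StandardBorelSpace X] (hE : CBER E)
    {F : Quotient E → Quotient E → Prop} {ψ : ℕ → Set (Quotient E × Quotient E)}
    (hψB : ∀ n, QBorelRel E E (ψ n)) (hψinj : ∀ n, IsPartialInj (ψ n))
    (hψsub : ∀ n, ∀ p ∈ ψ n, F p.1 p.2)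
    (hcover : ∀ x y : Quotient E, F x y → ∃ n, (x, y) ∈ ψ n)
    {g₀ : Set (Quotient E × Quotient E)} (hg₀B : QBorelRel E E g₀)
    (hg₀inj : IsPartialInj g₀) (hg₀sub : ∀ p ∈ g₀, F p.1 p.2) :
    ∃ g, g₀ ⊆ g ∧ QBorelRel E E g ∧ IsPartialInj g ∧ (∀ p ∈ g, F p.1 p.2) ∧
      ∀ x y, F x y → (∃ z, (x, z) ∈ g) ∨ ∃ z, (z, y) ∈ g := by
  let next : ℕ → Set (Quotient E × Quotient E) → Set (Quotient E × Quotient E) := fun n g =>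
    g ∪ (ψ n ∩ (Prod.fst ⁻¹' {x | ∃ y, (x, y) ∈ g}ᶜ ∩ Prod.snd ⁻¹' {y | ∃ x, (x, y) ∈ g}ᶜ))
  let G : ℕ → Set (Quotient E × Quotient E) := fun n => Nat.rec g₀ next n
  have hsucc : ∀ n x y, (x, y) ∈ G (n + 1) ↔ (x, y) ∈ G n ∨
      ((x, y) ∈ ψ n ∧ (¬ ∃ z, (x, z) ∈ G n) ∧ ¬ ∃ z, (z, y) ∈ G n) := fun _ _ _ => Iff.rfl
  have hmono : Monotone G := monotone_nat_of_le_succ fun n => subset_union_left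
  have hinj : ∀ n, IsPartialInj (G n) := by
    intro n
    induction n with
    | zero => exact hg₀inj
    | succ n ih =>
      constructor
      · intro x y y'
        have := ih.1 x y y'
        have := (hψinj n).1 x y y'
        grind
      · intro x x' y
        have := ih.2 x x' y
        have := (hψinj n).2 x x' y
        grind
  have hB : ∀ n, QBorelRel E E (G n) := by
    intro n
    induction n with
    | zero => exact hg₀B
    | succ n ih =>
      exact ih.union ((hψB n).inter ((ih.domain hE (hinj n).1).compl.preimage_fst.inter
        (ih.range hE (hinj n).2).compl.preimage_snd))
  have hsub : ∀ n, ∀ p ∈ G n, F p.1 p.2 := by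
    intro n
    induction n with
    | zero => exact hg₀sub
    | succ n ih => exact fun p hp => hp.elim (ih p) fun h => hψsub n p h.1
  have hmem : ∀ n, G n ⊆ ⋃ n, G n := subset_iUnion G
  refine ⟨⋃ n, G n, hmem 0, QBorelRel.iUnion hB, ⟨?_, ?_⟩, ?_, ?_⟩
  · intro x y y' h h'
    obtain ⟨n, hn⟩ := mem_iUnion.1 h
    obtain ⟨m, hm⟩ := mem_iUnion.1 h'
    exact (hinj (max n m)).1 x y y' (hmono (le_max_left n m) hn) (hmono (le_max_right n m) hm)
  · intro x x' y h h'
    obtain ⟨n, hn⟩ := mem_iUnion.1 h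
    obtain ⟨m, hm⟩ := mem_iUnion.1 h'
    exact (hinj (max n m)).2 x x' y (hmono (le_max_left n m) hn) (hmono (le_max_right n m) hm)
  · intro p hp
    obtain ⟨n, hn⟩ := mem_iUnion.1 hp
    exact hsub n p hn
  · intro x y hxy
    obtain ⟨n, hn⟩ := hcover x y hxy
    by_contra! hcon
    exact hcon.1 y (hmem (n + 1) ((hsucc n x y).2 (Or.inr ⟨hn,
      fun ⟨z, hz⟩ => hcon.1 z (hmem n hz), fun ⟨z, hz⟩ => hcon.2 z (hmem n hz)⟩)))

end QuotientBorel

/-- key lemma for Feldman–Moore on quotients: if `F` is an equivalence relation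
on a quotient Borel space enumerated by countably many Borel partial injections, then every
Borel partial injection contained in `F` is covered by two Borel automorphisms in the full
group of `F`. -/
theorem stmt_15 {X : Type} [MeasurableSpace X] [StandardBorelSpace X]
    (E : Setoid X) (hE : CBER E)
    (F : Quotient E → Quotient E → Prop) (hFeq : Equivalence F)
    (ψ : ℕ → Set (Quotient E × Quotient E))
    (hψB : ∀ n, QBorelRel E E (ψ n))
    (hψinj : ∀ n, IsPartialInj (ψ n))
    (hψsub : ∀ n, ∀ p ∈ ψ n, F p.1 p.2)
    (hcover : ∀ x y : Quotient E, F x y → ∃ n, (x, y) ∈ ψ n)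
    (g₀ : Set (Quotient E × Quotient E)) (hg₀B : QBorelRel E E g₀)
    (hg₀inj : IsPartialInj g₀) (hg₀sub : ∀ p ∈ g₀, F p.1 p.2) :
    ∃ g' g'' : Quotient E → Quotient E,
      Function.Bijective g' ∧ Function.Bijective g'' ∧
      QBorelFun E E g' ∧ QBorelFun E E g'' ∧
      (∀ x, F x (g' x)) ∧ (∀ x, F x (g'' x)) ∧
      ∀ p ∈ g₀, g' p.1 = p.2 ∨ g'' p.1 = p.2 := by
  obtain ⟨g, hg₀g, hgB, hg, hgF, hmax⟩ :=
    exists_maximal_borel_partialInj hE hψB hψinj hψsub hcover hg₀B hg₀inj hg₀sub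
  let A := initialOrbit g
  let B := initialOrbit (Prod.swap ⁻¹' g)
  have hAB : ∀ {n m x}, x ∈ A n → x ∉ B m := by
    intro n m x hA hB
    obtain ⟨z, hzx, hz⟩ := exists_notMem_range_of_mem_initialOrbit hFeq hgF hA
    obtain ⟨w, hwx, hw⟩ := exists_notMem_range_of_mem_initialOrbit hFeq
      (fun p hp => hFeq.symm (hgF p.swap hp)) hB
    exact (hmax w z (hFeq.trans hwx (hFeq.symm hzx))).elim hw hz
  have hAinj : ∀ {n m x}, x ∈ A n → x ∈ A m → n = m := eq_of_mem_initialOrbit hg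
  have hBinj : ∀ {n m x}, x ∈ B n → x ∈ B m → n = m := eq_of_mem_initialOrbit hg.swap
  have hAsucc : ∀ {x y}, (x, y) ∈ g → ∀ {n}, y ∈ A (n + 1) ↔ x ∈ A n := fun h =>
    mem_initialOrbit_succ_iff hg h
  have hBsucc : ∀ {x y}, (x, y) ∈ g → ∀ {n}, x ∈ B (n + 1) ↔ y ∈ B n := fun h =>
    mem_initialOrbit_succ_iff hg.swap h
  have hAzero : ∀ {x y}, (x, y) ∈ g → y ∉ A 0 := fun h => notMem_initialOrbit_zero h
  have hBzero : ∀ {x y}, (x, y) ∈ g → x ∉ B 0 := fun {x y} h =>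
    notMem_initialOrbit_zero (g := Prod.swap ⁻¹' g) (x := y) h
  have hAB' := hgB.initialOrbit hE hg
  have hBB := hgB.swap.initialOrbit hE hg.swap
  let C : Set (Quotient E) := ((⋃ n, A n) ∪ ⋃ n, B n)ᶜ
  have hC : ∀ {x}, x ∈ C ↔ (∀ n, x ∉ A n) ∧ ∀ n, x ∉ B n := by
    intro x
    simp only [C, mem_compl_iff, mem_union, mem_iUnion, not_or, not_exists]
  have hCB : QBorelSet E C :=
    (MeasurableSet.union (QBorelSet.iUnion hAB') (QBorelSet.iUnion hBB)).compl
  have hCedge : ∀ {x y}, (x, y) ∈ g → (x ∈ C ↔ y ∈ C) := by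
    intro x y h
    rw [hC, hC]
    constructor
    · rintro ⟨hA, hB⟩
      refine ⟨fun n hn => ?_, fun n hn => hB (n + 1) ((hBsucc h).2 hn)⟩
      cases n with
      | zero => exact hAzero h hn
      | succ n => exact hA n ((hAsucc h).1 hn)
    · rintro ⟨hA, hB⟩
      refine ⟨fun n hn => hA (n + 1) ((hAsucc h).2 hn), fun n hn => ?_⟩
      cases n with
      | zero => exact hBzero h hn
      | succ n => exact hB n ((hBsucc h).1 hn)
  have hCdom : ∀ {x}, x ∈ C → (∃ y, (x, y) ∈ g) ∧ ∃ y, (y, x) ∈ g := by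
    intro x hx
    have hA : ¬ ((∃ y, (x, y) ∈ g) ∧ ¬ ∃ w, (w, x) ∈ g) := (hC.1 hx).1 0
    have hB : ¬ ((∃ y, (y, x) ∈ g) ∧ ¬ ∃ w, (x, w) ∈ g) := (hC.1 hx).2 0
    have := hmax x x (hFeq.refl x)
    tauto
  let k : Set (Quotient E × Quotient E) := g ∩ Prod.fst ⁻¹' C
  let h : ℕ → Set (Quotient E × Quotient E) := fun b =>
    g ∩ ((⋃ n, ⋃ _ : n % 2 = b, Prod.fst ⁻¹' A n) ∪ ⋃ n, ⋃ _ : n % 2 = b, Prod.snd ⁻¹' B n)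
  have hh : ∀ {b x y}, (x, y) ∈ h b ↔ (x, y) ∈ g ∧
      ((∃ n, n % 2 = b ∧ x ∈ A n) ∨ ∃ n, n % 2 = b ∧ y ∈ B n) := by
    intro b x y
    simp only [h, mem_inter_iff, mem_union, mem_iUnion, mem_preimage, exists_prop]
  have hhB : ∀ b, QBorelRel E E (h b) := fun b =>
    hgB.inter (QBorelRel.union
      (.iUnion fun n => .iUnion fun _ => (hAB' n).preimage_fst)
      (.iUnion fun n => .iUnion fun _ => (hBB n).preimage_snd))
  have main : ∀ b, ∃ f : Quotient E → Quotient E, Bijective f ∧ QBorelFun E E f ∧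
      (∀ x, F x (f x)) ∧ ∀ p ∈ k ∪ h b, f p.1 = p.2 := by
    intro b
    refine exists_borel_automorphism_extending hE hFeq (hgB.inter hCB.preimage_fst) (hhB b) hCB
      (hg.mono inter_subset_left) (hg.mono inter_subset_left) (fun p hp => hgF p hp.1)
      (fun p hp => hgF p hp.1) ?_ ?_ ?_ ?_
    · refine fun x => ⟨fun hx => ?_, fun ⟨y, hy⟩ => hy.2⟩
      obtain ⟨y, hy⟩ := (hCdom hx).1
      exact ⟨y, hy, hx⟩
    · refine fun y => ⟨fun hy => ?_, fun ⟨x, hx⟩ => (hCedge hx.1).1 hx.2⟩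
      obtain ⟨x, hx⟩ := (hCdom hy).2
      exact ⟨x, hx, (hCedge hx).2 hy⟩
    · intro x y hxy
      obtain ⟨hxyg, hxy⟩ := hh.1 hxy
      rw [← hCedge hxyg, and_self]
      intro hx
      rcases hxy with ⟨n, -, hn⟩ | ⟨n, -, hn⟩
      · exact (hC.1 hx).1 n hn
      · exact (hC.1 ((hCedge hxyg).1 hx)).2 n hn
    · intro x y z hxy hyz
      obtain ⟨hxyg, hxy⟩ := hh.1 hxy
      obtain ⟨hyzg, hyz⟩ := hh.1 hyz
      rcases hxy with ⟨n, hnb, hn⟩ | ⟨n, hnb, hn⟩ <;> rcases hyz with ⟨m, hmb, hm⟩ | ⟨m, hmb, hm⟩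
      · have := hAinj ((hAsucc hxyg).2 hn) hm
        omega
      · exact hAB ((hAsucc hxyg).2 hn) ((hBsucc hyzg).2 hm)
      · exact hAB hm hn
      · have := hBinj ((hBsucc hyzg).2 hm) hn
        omega
  obtain ⟨g', hbij', hB', hF', hg'⟩ := main 0
  obtain ⟨g'', hbij'', hB'', hF'', hg''⟩ := main 1
  refine ⟨g', g'', hbij', hbij'', hB', hB'', hF', hF'', ?_⟩
  rintro ⟨x, y⟩ hp
  have hxy : (x, y) ∈ g := hg₀g hp
  have hcolor : (x, y) ∈ k ∨ ∃ n, (x, y) ∈ h (n % 2) := by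
    by_cases hx : x ∈ C
    · exact Or.inl ⟨hxy, hx⟩
    right
    rw [hC, not_and_or, not_forall_not, not_forall_not] at hx
    rcases hx with ⟨n, hn⟩ | ⟨n, hn⟩
    · exact ⟨n, hh.2 ⟨hxy, Or.inl ⟨n, rfl, hn⟩⟩⟩
    · cases n with
      | zero => exact (hBzero hxy hn).elim
      | succ n => exact ⟨n, hh.2 ⟨hxy, Or.inr ⟨n, rfl, (hBsucc hxy).1 hn⟩⟩⟩
  rcases hcolor with hk | ⟨n, hn⟩
  · exact Or.inl (hg' _ (Or.inl hk))
  · rcases Nat.mod_two_eq_zero_or_one n with hb | hb <;> rw [hb] at hn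
    · exact Or.inl (hg' _ (Or.inr hn))
    · exact Or.inr (hg'' _ (Or.inr hn))
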